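/- Let q = p^m ≥ 3, s ≥ 1, χ ∈ F_q nonzero, and G = χ·F_p. Suppose there is no G-fixed c-Wieferich prime in F_q[T] of degree ps. Then for every integer k ≥ 0 with p not dividing r = 1 + sk, no G-fixed monic irreducible polynomial of degree ps in F_q[T] is a c-Wieferich prime in F_{q^r}[T]; that is, no such polynomial divides F_{q^r, ps−1}. -/

import Mathlib

open Polynomial

/-- The sequence of polynomials `F_{Q,0} = 1`, `F_{Q,i} = (−1)^i + (T^{Q^i} − T)·F_{Q,i−1}`. -/
noncomputable def Fseq (q : ℕ) (K : Type*) [Field K] : ℕ → Polynomial K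
  | 0 => 1
  | i + 1 => (-1 : Polynomial K) ^ (i + 1) + (X ^ q ^ (i + 1) - X) * Fseq q K i

open FiniteField in
theorem frobeniusAlgHom_pow_apply (F : Type*) [Field F] [Fintype F] {L : Type*} [CommRing L]
    [Algebra F L] (n : ℕ) (x : L) :
    (frobeniusAlgHom F L ^ n) x = x ^ Fintype.card F ^ n := by
  rw [AlgHom.coe_pow, coe_frobeniusAlgHom, pow_iterate]

/-- Iterating an algebra endomorphism which translates `x` by a scalar. -/
theorem AlgHom.pow_apply_of_apply_eq_add {F L : Type*} [Field F] [CommRing L] [Algebra F L]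
    {σ : L →ₐ[F] L} {x : L} {a : F} (h : σ x = x + algebraMap F L a) (n : ℕ) :
    (σ ^ n) x = x + algebraMap F L (n * a) := by
  induction n with
  | zero => simp
  | succ n ih =>
    rw [pow_succ, AlgHom.mul_apply, h, map_add, ih, AlgHom.commutes, add_assoc, ← map_add]
    congr 2
    push_cast
    ring

open FiniteField in
theorem natDegree_minpoly_dvd_iff (F : Type*) [Field F] [Fintype F] {L : Type*} [Field L]
    [Algebra F L] [Algebra.IsAlgebraic F L] (x : L) (n : ℕ) :
    (minpoly F x).natDegree ∣ n ↔ (frobeniusAlgHom F L ^ n) x = x := by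
  have hx : IsIntegral F x := (Algebra.IsAlgebraic.isAlgebraic x).isIntegral
  rw [(minpoly.irreducible hx).natDegree_dvd_iff_dvd_X_pow_card_pow_sub_X, minpoly.dvd_iff,
    frobeniusAlgHom_pow_apply, Nat.card_eq_fintype_card]
  simp [sub_eq_zero]

open FiniteField in
theorem isConjRoot_iff_exists_frobenius_pow {F : Type*} [Field F] [Fintype F] {L : Type*} [Field L]
    [Algebra F L] [Normal F L] {x y : L} :
    IsConjRoot F x y ↔ ∃ j : ℕ, y = (frobeniusAlgHom F L ^ j) x := by
  constructor
  · intro h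
    obtain ⟨σ, rfl⟩ := isConjRoot_iff_exists_algEquiv.1 h.symm
    obtain ⟨p, hp⟩ := CharP.exists F
    have : Fact p.Prime := ⟨CharP.char_is_prime F p⟩
    have hx : IsIntegral F x := Normal.isIntegral ‹_› x
    have : FiniteDimensional F (IntermediateField.adjoin F {x}) :=
      IntermediateField.adjoin.finiteDimensional hx
    have : Finite (IntermediateField.adjoin F {x}) := Module.finite_of_finite F
    obtain ⟨j, hj⟩ := exists_forall_apply_eq_pow F p _
      (σ.restrictNormal (IntermediateField.adjoin F {x}))
    refine ⟨j, ?_⟩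
    have h2 := σ.restrictNormal_commutes (IntermediateField.adjoin F {x})
      (IntermediateField.AdjoinSimple.gen F x)
    rw [hj, map_pow, IntermediateField.AdjoinSimple.algebraMap_gen] at h2
    rw [frobeniusAlgHom_pow_apply, ← Nat.card_eq_fintype_card, h2]
  · rintro ⟨j, rfl⟩
    refine isConjRoot_of_aeval_eq_zero (Normal.isIntegral ‹_› x) ?_
    rw [aeval_algHom_apply, minpoly.aeval, map_zero]

theorem Fseq_map {K L : Type*} [Field K] [Field L] (f : K →+* L) (q n : ℕ) :
    (Fseq q K n).map f = Fseq q L n := by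
  induction n with
  | zero => simp [Fseq]
  | succ n ih => simp [Fseq, ih]

theorem Fseq_eval_congr {L : Type*} [Field L] {q q' : ℕ} {x y : L}
    (h : ∀ i, x ^ q ^ i - x = y ^ q' ^ i - y) (n : ℕ) :
    (Fseq q L n).eval x = (Fseq q' L n).eval y := by
  induction n with
  | zero => simp [Fseq]
  | succ n ih => simp [Fseq, ih, h]

open FiniteField in
/-- If `x` has degree `p * s` over `F` and is conjugate to `x + a` for some nonzero scalar `a`,
then the `s`-th power of Frobenius translates `x` by a nonzero multiple of `a`. -/
theorem exists_frobenius_pow_apply_eq_add {F : Type*} [Field F] [Fintype F] {p s : ℕ}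
    [Fact p.Prime] [CharP F p] {L : Type*} [Field L] [Algebra F L] [Normal F L] {x : L} {a : F}
    (ha : a ≠ 0) (hdeg : (minpoly F x).natDegree = p * s)
    (hconj : IsConjRoot F x (x + algebraMap F L a)) :
    ∃ v : ℕ, ¬ p ∣ v ∧ (frobeniusAlgHom F L ^ s) x = x + algebraMap F L (v * a) := by
  have hp : p.Prime := Fact.out
  have : Algebra.IsAlgebraic F L := Normal.toIsAlgebraic
  obtain ⟨j, hj⟩ := isConjRoot_iff_exists_frobenius_pow.1 hconj
  have hiter := AlgHom.pow_apply_of_apply_eq_add hj.symm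
  have hjp : p * s ∣ j * p := by
    rw [← hdeg, natDegree_minpoly_dvd_iff, pow_mul, hiter]
    simp
  obtain ⟨u, rfl⟩ : s ∣ j := by
    rw [mul_comm] at hjp
    exact Nat.dvd_of_mul_dvd_mul_right hp.pos hjp
  have hu : ¬ p ∣ u := by
    rintro ⟨w, rfl⟩
    have : (frobeniusAlgHom F L ^ (s * (p * w))) x = x := by
      rw [← natDegree_minpoly_dvd_iff, hdeg]
      exact ⟨w, by ring⟩
    rw [this] at hj
    simp [ha] at hj
  obtain ⟨v, hv⟩ : ∃ v : ℕ, u * v ≡ 1 [MOD p] :=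
    ⟨_, (Nat.exists_mul_mod_eq_one_of_coprime ((hp.coprime_iff_not_dvd.2 hu).symm)
      hp.one_lt).choose_spec.2.trans (Nat.mod_eq_of_lt hp.one_lt).symm⟩
  refine ⟨v, fun hpv => hp.one_lt.ne' ?_, ?_⟩
  · exact Nat.dvd_one.1 ((hv.dvd_iff dvd_rfl).1 (hpv.mul_left u))
  have hmod : s * u * v ≡ s [MOD p * s] := by
    simpa only [mul_assoc, mul_one, mul_comm p s] using hv.mul_left' s
  rw [← hiter, ← pow_mul]
  have hmod_period : ∀ n,
      (frobeniusAlgHom F L ^ n) x = (frobeniusAlgHom F L ^ (n % (p * s))) x := by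
    intro n
    conv_lhs => rw [← Nat.mod_add_div n (p * s)]
    rw [pow_add, AlgHom.mul_apply,
      (natDegree_minpoly_dvd_iff F x _).1 (hdeg.dvd.trans (dvd_mul_right _ _))]
  rw [hmod_period (s * u * v), hmod, ← hmod_period]

open FiniteField in
/-- The translate of `x` by a solution `l` of `l ^ q - l = k * b`. -/
theorem exists_isConjRoot_twist {F : Type*} [Field F] [Fintype F] {p s k : ℕ}
    [Fact p.Prime] [CharP F p] {L : Type*} [Field L] [Algebra F L] [IsAlgClosed L]
    [Algebra.IsAlgebraic F L] (hk : ¬ p ∣ 1 + s * k) {x : L} {a : F}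
    (ha : a ≠ 0) (hdeg : (minpoly F x).natDegree = p * s)
    (hconj : IsConjRoot F x (x + algebraMap F L a)) :
    ∃ y : L, (minpoly F y).natDegree = p * s ∧ IsConjRoot F y (y + algebraMap F L a) ∧
      ∀ i, x ^ (Fintype.card F ^ (1 + s * k)) ^ i - x = y ^ Fintype.card F ^ i - y := by
  have hp : p.Prime := Fact.out
  have : IsAlgClosure F L := ⟨‹_›, ‹_›⟩
  have : Normal F L := IsAlgClosure.normal F L
  obtain ⟨v, hv, hs⟩ := exists_frobenius_pow_apply_eq_add ha hdeg hconj
  set σ := frobeniusAlgHom F L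
  set b : F := v * a
  obtain ⟨l, hl⟩ : ∃ l : L, σ l = l + algebraMap F L (k * b) := by
    have hq := Fintype.one_lt_card (α := F)
    have hdeg' : (X ^ Fintype.card F - X - C (algebraMap F L (k * b))).natDegree =
        Fintype.card F := by
      rw [natDegree_sub_C, X_pow_card_sub_X_natDegree_eq L hq]
    obtain ⟨l, hl⟩ := IsAlgClosed.exists_root
      (X ^ Fintype.card F - X - C (algebraMap F L (k * b))) (fun h => by
        rw [natDegree_eq_zero_iff_degree_le_zero.2 h.le] at hdeg'
        omega)
    refine ⟨l, ?_⟩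
    simp only [IsRoot.def, eval_sub, eval_pow, eval_X, eval_C] at hl
    change l ^ Fintype.card F = _
    linear_combination hl
  have hli := AlgHom.pow_apply_of_apply_eq_add hl
  have hsi := AlgHom.pow_apply_of_apply_eq_add hs
  have hy : (σ ^ s) (x + l) = x + l + algebraMap F L ((1 + s * k : ℕ) * b) := by
    rw [map_add, hs, hli]
    push_cast [map_add, map_mul]
    ring
  have hyi := AlgHom.pow_apply_of_apply_eq_add hy
  have hxr : ∀ i, (σ ^ ((1 + s * k) * i)) x = (σ ^ i) (x + l) - l := by
    intro i
    rw [show (1 + s * k) * i = i + s * (k * i) by ring, pow_add, AlgHom.mul_apply, pow_mul, hsi,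
      map_add, AlgHom.commutes, map_add, hli]
    push_cast [map_add, map_mul]
    ring
  refine ⟨x + l, Nat.dvd_antisymm ?_ ?_, ?_, fun i => ?_⟩
  · rw [natDegree_minpoly_dvd_iff, mul_comm, pow_mul, hyi]
    simp
  · have hcop : Nat.Coprime (p * s) (1 + s * k) := by
      refine Nat.Coprime.mul_left ((hp.coprime_iff_not_dvd).2 hk) ?_
      simp
    refine hcop.dvd_of_dvd_mul_left ?_
    rw [← hdeg, natDegree_minpoly_dvd_iff, hxr, (natDegree_minpoly_dvd_iff F _ _).1 dvd_rfl]
    ring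
  · rw [isConjRoot_iff_exists_frobenius_pow]
    have hcop : Nat.Coprime (v * (1 + s * k)) p := by
      rw [Nat.coprime_comm, hp.coprime_iff_not_dvd, hp.dvd_mul]
      tauto
    obtain ⟨t, -, ht⟩ := Nat.exists_mul_mod_eq_one_of_coprime hcop hp.one_lt
    refine ⟨s * t, ?_⟩
    rw [pow_mul, hyi]
    congr 2
    have h1 : ((v * (1 + s * k) * t : ℕ) : F) = 1 := by
      rw [CharP.cast_eq_mod F p, ht, Nat.cast_one]
    push_cast at h1 ⊢
    linear_combination -a * h1
  · have := hxr i
    rw [frobeniusAlgHom_pow_apply, frobeniusAlgHom_pow_apply] at this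
    rw [← pow_mul, this]
    ring

theorem minpoly_comp_X_add_C_eq_iff {F L : Type*} [Field F] [Field L] [Algebra F L] {x : L}
    (a : F) : (minpoly F x).comp (X + C a) = minpoly F x ↔
      IsConjRoot F x (x + algebraMap F L a) := by
  rw [isConjRoot_def, minpoly.add_algebraMap]
  constructor <;> intro h
  · conv_rhs => rw [← h]
    simp [comp_assoc]
  · conv_lhs => rw [h]
    simp [comp_assoc]

/-- Invariance under translation by `a` extends to the additive subgroup generated by `a`. -/
theorem comp_X_add_C_eq_of_mem_closure {R : Type*} [CommRing R] {P : R[X]} {a b : R}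
    (h : P.comp (X + C a) = P) (hb : b ∈ AddSubgroup.closure {a}) : P.comp (X + C b) = P := by
  have hadd : ∀ c d : R, (P.comp (X + C c)).comp (X + C d) = P.comp (X + C (c + d)) := by
    intro c d
    rw [comp_assoc]
    simp [add_assoc, add_comm (C d)]
  induction hb using AddSubgroup.closure_induction with
  | mem x hx => rwa [Set.mem_singleton_iff.1 hx]
  | zero => simp
  | add x y _ _ hx hy => rw [← hadd, hx, hy]
  | neg x _ hx => nth_rw 1 [← hx]; rw [hadd]; simp

/-- Let `q = p^m ≥ 3`, `s ≥ 1`, `χ ∈ F_q` nonzero, `G = χ·F_p`.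
Suppose there is no `G`-fixed c-Wieferich prime in `F_q[T]` of degree `ps`.  Then for
every integer `k ≥ 0` with `p ∤ r = 1 + sk`, no `G`-fixed monic irreducible polynomial
of degree `ps` in `F_q[T]` is a c-Wieferich prime in `F_{q^r}[T]`, i.e. no such
polynomial divides `F_{q^r, ps−1}`. -/
theorem stmt14 (p m s : ℕ) (hp : p.Prime) (hq3 : 3 ≤ p ^ m) (hs : 0 < s)
    (F : Type) [Field F] [Fintype F] (hF : Fintype.card F = p ^ m)
    (χ : F) (hχ : χ ≠ 0)
    (hnone : ¬ ∃ P : Polynomial F, P.Monic ∧ Irreducible P ∧ P.natDegree = p * s ∧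
      (∀ a ∈ AddSubgroup.closure {χ}, P.comp (X + C a) = P) ∧
      P ∣ Fseq (p ^ m) F (p * s - 1)) :
    ∀ k : ℕ, ¬ p ∣ (1 + s * k) →
      ∀ Q : Polynomial F, Q.Monic → Irreducible Q → Q.natDegree = p * s →
        (∀ a ∈ AddSubgroup.closure {χ}, Q.comp (X + C a) = Q) →
        ∀ (K : Type) [Field K] [Fintype K] [Algebra F K],
          Module.finrank F K = 1 + s * k →
          ¬ Q.map (algebraMap F K) ∣ Fseq ((p ^ m) ^ (1 + s * k)) K (p * s - 1) := by
  intro k hk Q hQm hQi hQd hQfix K _ _ _ _ hdvd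
  have : Fact p.Prime := ⟨hp⟩
  have : CharP F p := by
    obtain ⟨p', h⟩ := CharP.exists F
    have hp' := CharP.char_is_prime F p'
    obtain ⟨n, -, hn⟩ := FiniteField.card F p'
    have hpp : p' ∣ p ^ m := by
      rw [← hF, hn]
      exact dvd_pow_self _ n.ne_zero
    rwa [← (Nat.prime_dvd_prime_iff_eq hp' hp).1 (hp'.dvd_of_dvd_pow hpp)]
  let L := AlgebraicClosure K
  have : Algebra.IsAlgebraic F K := Algebra.IsAlgebraic.of_finite F K
  have : Algebra.IsAlgebraic F L := Algebra.IsAlgebraic.trans F K L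
  obtain ⟨x, hx⟩ := IsAlgClosed.exists_aeval_eq_zero L Q hQi.degree_pos.ne'
  obtain rfl := minpoly.eq_of_irreducible_of_monic hQi hx hQm
  have hxconj := (minpoly_comp_X_add_C_eq_iff χ).1
    (hQfix χ (AddSubgroup.subset_closure (Set.mem_singleton χ)))
  obtain ⟨y, hyd, hyconj, hxy⟩ := exists_isConjRoot_twist hk hχ hQd hxconj
  have hy : IsIntegral F y := (Algebra.IsAlgebraic.isAlgebraic y).isIntegral
  refine hnone ⟨minpoly F y, minpoly.monic hy, minpoly.irreducible hy, hyd, fun a ha =>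
    comp_X_add_C_eq_of_mem_closure ((minpoly_comp_X_add_C_eq_iff χ).2 hyconj) ha, ?_⟩
  rw [minpoly.dvd_iff, aeval_def, ← eval_map, Fseq_map, ← hF, ← Fseq_eval_congr hxy, hF,
    ← Fseq_map (algebraMap K L), eval_map, ← aeval_def]
  refine aeval_eq_zero_of_dvd_aeval_eq_zero hdvd ?_
  rw [aeval_map_algebraMap, minpoly.aeval]
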